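/- Let G = (V, E) be a directed graph and k ≥ 1 an integer. Then G contains an elementary directed cycle of length strictly greater than k if and only if there exist pairwise distinct vertices a_1,…,a_{k+1} with (a_i, a_{i+1}) ∈ E for all 1 ≤ i ≤ k, together with a directed path in G from a_{k+1} to a_1 that uses no edge whose tail belongs to {a_1,…,a_k}. -/

import Mathlib

attribute [local instance] Classical.propDecidable

noncomputable section

/-- A term is either a variable (`Sum.inl v`) or a constant (`Sum.inr c`),
variables and constants both being coded by natural numbers
(the two copies of `ℕ` are disjoint). -/
abbrev Trm := ℕ ⊕ ℕ

/-- A database schema assigns to every relation name (a natural number) an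
arity `n` and a primary-key length `k` with `n ≥ k ≥ 1`; the primary key
consists of the first `k` positions. -/
structure Schema where
  arity : ℕ → ℕ
  keyLen : ℕ → ℕ
  keyLen_le_arity : ∀ R, keyLen R ≤ arity R
  one_le_keyLen : ∀ R, 1 ≤ keyLen R

/-- An atom: a relation name together with a list of arguments. -/
structure Atom where
  rel : ℕ
  args : List Trm
deriving DecidableEq

/-- Variables occurring in a list of terms. -/
def varsL (l : List Trm) : Finset ℕ := (l.filterMap Sum.getLeft?).toFinset

/-- Constants occurring in a list of terms. -/
def constsL (l : List Trm) : Finset ℕ := (l.filterMap Sum.getRight?).toFinset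

/-- All variables of an atom. -/
def varsA (A : Atom) : Finset ℕ := varsL A.args

/-- Key variables of an atom: variables in the primary-key positions. -/
def keyVars (S : Schema) (A : Atom) : Finset ℕ := varsL (A.args.take (S.keyLen A.rel))

/-- Constants of an atom. -/
def constsA (A : Atom) : Finset ℕ := constsL A.args

/-- Well-formed atom: number of arguments equals the arity of its relation name. -/
def wfAtom (S : Schema) (A : Atom) : Prop := A.args.length = S.arity A.rel

/-- A fact is an atom without variables. -/
def isFact (A : Atom) : Prop := ∀ t ∈ A.args, ∃ c : ℕ, t = Sum.inr c

/-- Two (facts) are key-equal: same relation name, and same primary-key positions. -/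
def keyEqual (S : Schema) (A B : Atom) : Prop :=
  A.rel = B.rel ∧ A.args.take (S.keyLen A.rel) = B.args.take (S.keyLen B.rel)

/-- The block of `A` in `db`: all facts of `db` key-equal to `A`. -/
def block (S : Schema) (A : Atom) (db : Finset Atom) : Finset Atom :=
  db.filter (fun B => keyEqual S A B)

/-- An uncertain database: a finite set of well-formed facts. -/
def IsDb (S : Schema) (db : Finset Atom) : Prop := ∀ A ∈ db, isFact A ∧ wfAtom S A

/-- A set of facts is consistent if it contains no two distinct key-equal facts. -/
def Consistent (S : Schema) (db : Finset Atom) : Prop :=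
  ∀ A ∈ db, ∀ B ∈ db, keyEqual S A B → A = B

/-- A repair of `db`: a maximal consistent subset of `db`. -/
def IsRepair (S : Schema) (db r : Finset Atom) : Prop :=
  r ⊆ db ∧ Consistent S r ∧
    ∀ r' : Finset Atom, r ⊆ r' → r' ⊆ db → Consistent S r' → r' = r

/-- Applying a valuation (a total map from variables to constants) to a term. -/
def appT (θ : ℕ → ℕ) : Trm → Trm
  | Sum.inl v => Sum.inr (θ v)
  | Sum.inr c => Sum.inr c

/-- Applying a valuation to an atom. -/
def appA (θ : ℕ → ℕ) (A : Atom) : Atom := ⟨A.rel, A.args.map (appT θ)⟩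

/-- Applying a valuation to a query. -/
def appQ (θ : ℕ → ℕ) (q : Finset Atom) : Finset Atom := q.image (appA θ)

/-- `db ⊨ q`: some valuation sends every atom of `q` into `db`. -/
def Sat (db q : Finset Atom) : Prop := ∃ θ : ℕ → ℕ, appQ θ q ⊆ db

/-- `db ∈ CERTAINTY(q)`: every repair of `db` satisfies `q`. -/
def Certainty (S : Schema) (q db : Finset Atom) : Prop :=
  ∀ r : Finset Atom, IsRepair S db r → Sat r q

/-- Variables of a query. -/
def varsQ (q : Finset Atom) : Finset ℕ := q.biUnion varsA

/-- Constants of a query. -/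
def constsQ (q : Finset Atom) : Finset ℕ := q.biUnion constsA

/-- `q` has no self-join: no two distinct atoms share a relation name. -/
def NoSelfJoin (q : Finset Atom) : Prop := ∀ F ∈ q, ∀ G ∈ q, F.rel = G.rel → F = G

/-- `db` is purified relative to `q`. -/
def Purified (q db : Finset Atom) : Prop :=
  ∀ A ∈ db, ∃ θ : ℕ → ℕ, A ∈ appQ θ q ∧ appQ θ q ⊆ db

/-- Active domain of a database: all constants occurring in its facts. -/
def adom (db : Finset Atom) : Finset ℕ := db.biUnion constsA

/-- Membership in the attribute closure of `X` under a set `FDs` of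
functional dependencies (standard implication of functional dependencies). -/
inductive InCl (FDs : Set (Finset ℕ × Finset ℕ)) (X : Finset ℕ) : ℕ → Prop
  | base {x : ℕ} : x ∈ X → InCl FDs X x
  | step {Z W : Finset ℕ} {w : ℕ} : (Z, W) ∈ FDs → (∀ z ∈ Z, InCl FDs X z) →
      w ∈ W → InCl FDs X w

/-- `FDs ⊨ X → Y`. -/
def FDImp (FDs : Set (Finset ℕ × Finset ℕ)) (X Y : Finset ℕ) : Prop :=
  ∀ y ∈ Y, InCl FDs X y

/-- `FD(q) = { key(F) → vars(F) : F ∈ q }`. -/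
def FDq (S : Schema) (q : Finset Atom) : Set (Finset ℕ × Finset ℕ) :=
  {p | ∃ F ∈ q, p = (keyVars S F, varsA F)}

/-- `F^{+,q} = {x ∈ vars(q) : FD(q \ {F}) ⊨ key(F) → x}`. -/
def plusCl (S : Schema) (q : Finset Atom) (F : Atom) : Set ℕ :=
  {x | x ∈ varsQ q ∧ InCl (FDq S (q.erase F)) (keyVars S F) x}

/-- `F^{⊕,q} = {x ∈ vars(q) : FD(q) ⊨ key(F) → x}`. -/
def oplusCl (S : Schema) (q : Finset Atom) (F : Atom) : Set ℕ :=
  {x | x ∈ varsQ q ∧ InCl (FDq S q) (keyVars S F) x}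

/-- A (simple) path in an undirected graph given by edge relation `E`. -/
def IsPath (E : Atom → Atom → Prop) (p : List Atom) : Prop :=
  p ≠ [] ∧ p.Nodup ∧ List.Chain' E p

/-- `E` is (the edge relation of) a join tree for `q`: a tree (unique simple
paths between any two vertices) on the atoms of `q` satisfying the
Connectedness Condition. -/
def IsJoinTree (q : Finset Atom) (E : Atom → Atom → Prop) : Prop :=
  (∀ a b, E a b → E b a) ∧
  (∀ a b, E a b → a ∈ q ∧ b ∈ q ∧ a ≠ b) ∧
  (∀ a ∈ q, ∀ b ∈ q, ∃! p : List Atom,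
      IsPath E p ∧ p.head? = some a ∧ p.getLast? = some b) ∧
  (∀ x : ℕ, ∀ F ∈ q, ∀ G ∈ q, x ∈ varsA F → x ∈ varsA G →
      ∀ p : List Atom, IsPath E p → p.head? = some F → p.getLast? = some G →
        ∀ H ∈ p, x ∈ varsA H)

/-- The consecutive pairs (edges) of a path. -/
def edgePairs (p : List Atom) : List (Atom × Atom) := p.zip p.tail

/-- `F ↝ G` in the attack graph of the join tree `E` of `q`: `F ≠ G` are atoms
of `q`, and no label `vars(H) ∩ vars(H')` of an edge on the (unique) path from
`F` to `G` is contained in `F^{+,q}`. -/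
def Attacks (S : Schema) (q : Finset Atom) (E : Atom → Atom → Prop) (F G : Atom) : Prop :=
  F ∈ q ∧ G ∈ q ∧ F ≠ G ∧
  ∀ p : List Atom, IsPath E p → p.head? = some F → p.getLast? = some G →
    ∀ e ∈ edgePairs p, ¬ ((↑(varsA e.1 ∩ varsA e.2) : Set ℕ) ⊆ plusCl S q F)

/-- The attack `F ↝ G` is weak: `key(G) ⊆ F^{⊕,q}`. -/
def Weak (S : Schema) (q : Finset Atom) (F G : Atom) : Prop :=
  (↑(keyVars S G) : Set ℕ) ⊆ oplusCl S q F

/-- Consecutive pairs of a cyclic sequence, including the wrap-around pair. -/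
def cyclePairs (L : List Atom) : List (Atom × Atom) := L.zip (L.rotate 1)

/-- `L` is an (elementary directed) cycle in the directed graph `att`. -/
def IsCycle (att : Atom → Atom → Prop) (L : List Atom) : Prop :=
  2 ≤ L.length ∧ L.Nodup ∧ ∀ e ∈ cyclePairs L, att e.1 e.2

/-- A cycle is terminal: no edge leads from a vertex in the cycle to a vertex
outside the cycle. -/
def TerminalCycle (att : Atom → Atom → Prop) (L : List Atom) : Prop :=
  ∀ a ∈ L, ∀ b, att a b → b ∈ L

/-- A strong cycle in the attack graph: a cycle at least one attack of which is strong. -/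
def StrongCycle (S : Schema) (q : Finset Atom) (E : Atom → Atom → Prop)
    (L : List Atom) : Prop :=
  IsCycle (Attacks S q E) L ∧ ∃ e ∈ cyclePairs L, ¬ Weak S q e.1 e.2

/-- Substituting constant `c` for variable `z` in a term. -/
def substT (z c : ℕ) : Trm → Trm
  | Sum.inl v => if v = z then Sum.inr c else Sum.inl v
  | Sum.inr d => Sum.inr d

/-- `F[z→c]`. -/
def substA (z c : ℕ) (A : Atom) : Atom := ⟨A.rel, A.args.map (substT z c)⟩

/-- `q[z→c]`. -/
def substQ (z c : ℕ) (q : Finset Atom) : Finset Atom := q.image (substA z c)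

/-- Simultaneous substitution of the constants `bs` for the (distinct)
variables `xs` (componentwise) in a term. -/
def substLT (xs bs : List ℕ) : Trm → Trm
  | Sum.inl v => if v ∈ xs then Sum.inr (bs.getD (xs.idxOf v) 0) else Sum.inl v
  | Sum.inr d => Sum.inr d

/-- `F[x⃗→b⃗]`. -/
def substLA (xs bs : List ℕ) (A : Atom) : Atom := ⟨A.rel, A.args.map (substLT xs bs)⟩

/-- `q[x⃗→b⃗]`. -/
def substLQ (xs bs : List ℕ) (q : Finset Atom) : Finset Atom := q.image (substLA xs bs)

/-- First-order formulas over the relational vocabulary (relation names and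
constants coded by naturals, variables coded by naturals). -/
inductive Fml where
  | atom (R : ℕ) (args : List Trm)
  | eq (s t : Trm)
  | tru
  | not (φ : Fml)
  | and (φ ψ : Fml)
  | or (φ ψ : Fml)
  | ex (v : ℕ) (φ : Fml)
  | all (v : ℕ) (φ : Fml)

/-- Value of a term under an assignment of constants to variables. -/
def evalT (σ : ℕ → ℕ) : Trm → ℕ
  | Sum.inl v => σ v
  | Sum.inr c => c

/-- Satisfaction of a first-order formula in the finite structure whose
relations are given by the facts of `db`, with quantifiers ranging over `dom`. -/
def Holds (db : Finset Atom) (dom : Finset ℕ) : Fml → (ℕ → ℕ) → Prop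
  | .atom R args, σ => (⟨R, args.map fun t => Sum.inr (evalT σ t)⟩ : Atom) ∈ db
  | .eq s t, σ => evalT σ s = evalT σ t
  | .tru, _ => True
  | .not φ, σ => ¬ Holds db dom φ σ
  | .and φ ψ, σ => Holds db dom φ σ ∧ Holds db dom ψ σ
  | .or φ ψ, σ => Holds db dom φ σ ∨ Holds db dom ψ σ
  | .ex v φ, σ => ∃ a ∈ dom, Holds db dom φ (Function.update σ v a)
  | .all v φ, σ => ∀ a ∈ dom, Holds db dom φ (Function.update σ v a)

/-- Free variables of a formula. -/
def Fml.free : Fml → Finset ℕ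
  | .atom _ args => varsL args
  | .eq s t => varsL [s, t]
  | .tru => ∅
  | .not φ => φ.free
  | .and φ ψ => φ.free ∪ ψ.free
  | .or φ ψ => φ.free ∪ ψ.free
  | .ex v φ => φ.free.erase v
  | .all v φ => φ.free.erase v

/-- Relation names occurring in a formula. -/
def Fml.rels : Fml → Finset ℕ
  | .atom R _ => {R}
  | .eq _ _ => ∅
  | .tru => ∅
  | .not φ => φ.rels
  | .and φ ψ => φ.rels ∪ ψ.rels
  | .or φ ψ => φ.rels ∪ ψ.rels
  | .ex _ φ => φ.rels
  | .all _ φ => φ.rels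

/-- Constants occurring in a formula. -/
def Fml.consts : Fml → Finset ℕ
  | .atom _ args => constsL args
  | .eq s t => constsL [s, t]
  | .tru => ∅
  | .not φ => φ.consts
  | .and φ ψ => φ.consts ∪ ψ.consts
  | .or φ ψ => φ.consts ∪ ψ.consts
  | .ex _ φ => φ.consts
  | .all _ φ => φ.consts

/-- Well-formed formula: every atom has as many arguments as the arity of its
relation name. -/
def FmlWf (S : Schema) : Fml → Prop
  | .atom R args => args.length = S.arity R
  | .eq _ _ => True
  | .tru => True
  | .not φ => FmlWf S φ
  | .and φ ψ => FmlWf S φ ∧ FmlWf S ψ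
  | .or φ ψ => FmlWf S φ ∧ FmlWf S ψ
  | .ex _ φ => FmlWf S φ
  | .all _ φ => FmlWf S φ

/-- The safety predicate of Dalvi, Ré and Suciu (rules SE1–SE4). -/
inductive Safe (S : Schema) : Finset Atom → Prop
  | se1 (A : Atom) : isFact A → Safe S {A}
  | se2 (q₁ q₂ : Finset Atom) : q₁.Nonempty → q₂.Nonempty →
      Disjoint (varsQ q₁) (varsQ q₂) → Safe S q₁ → Safe S q₂ → Safe S (q₁ ∪ q₂)
  | se3 (q : Finset Atom) (x a : ℕ) : (∀ F ∈ q, x ∈ keyVars S F) →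
      Safe S (substQ x a q) → Safe S q
  | se4 (q : Finset Atom) (F : Atom) (x a : ℕ) : F ∈ q → keyVars S F = ∅ →
      varsA F ≠ ∅ → x ∈ varsA F → Safe S (substQ x a q) → Safe S q

/-- The atom `R_i(x_i ; x_{i+1})` (with `x_{k+1} = x_1`) of the query `acq_k`;
variable `x_i` is coded by `i`, relation name `R_i` by `i`. -/
def Ratom (k i : ℕ) : Atom := ⟨i, [Sum.inl i, Sum.inl (i % k + 1)]⟩

/-- The all-key atom `S_k(x_1,…,x_k)` of the query `acq_k`;
relation name `S_k` is coded by `0`. -/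
def Satom (k : ℕ) : Atom := ⟨0, (List.range k).map (fun j => Sum.inl (j + 1))⟩

/-- The query `acq_k = {R_1(x_1;x_2), …, R_k(x_k;x_1), S_k(x_1,…,x_k)}`. -/
def acq (k : ℕ) : Finset Atom := ((Finset.Icc 1 k).image (Ratom k)) ∪ {Satom k}

/-- Sum of `Pr` over the possible (= consistent) worlds of `db` satisfying `P`. -/
def prOf (S : Schema) (db : Finset Atom) (Pr : Finset Atom → ℚ)
    (P : Finset Atom → Prop) : ℚ :=
  ∑ w ∈ db.powerset.filter (fun w => Consistent S w ∧ P w), Pr w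

end
theorem aux_isChain_zip {V : Type*} (E : V → V → Prop) :
    ∀ (t : List V) (x y : V), (∀ e ∈ (x :: t).zip (t ++ [y]), E e.1 e.2) ↔
      List.IsChain E (x :: (t ++ [y]))
  | [], x, y => by simp
  | z :: t, x, y => by
    have ih := aux_isChain_zip E t z y
    simp only [List.cons_append, List.zip_cons_cons, List.forall_mem_cons,
      List.isChain_cons_cons] at ih ⊢
    rw [ih]

theorem aux_mem_zip_tail {V : Type*} :
    ∀ (q : List V) (y x : V), x ∈ q → ∃ z, (x, z) ∈ (q ++ [y]).zip (q ++ [y]).tail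
  | [], y, x, h => by simp at h
  | [w], y, x, h => by
    simp at h; subst h; exact ⟨y, by simp⟩
  | w :: v :: q, y, x, h => by
    rcases List.mem_cons.1 h with h | h
    · subst h; exact ⟨v, by simp⟩
    · obtain ⟨z, hz⟩ := aux_mem_zip_tail (v :: q) y x h
      exact ⟨z, by simp at hz ⊢; tauto⟩

/-- A directed graph contains an elementary directed cycle of
length strictly greater than `k` iff there are pairwise distinct vertices
`a_1, …, a_{k+1}` with `(a_i, a_{i+1}) ∈ E` for `1 ≤ i ≤ k`, together with a
directed path from `a_{k+1}` to `a_1` using no edge whose tail belongs to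
`{a_1, …, a_k}`. -/
theorem statement17 {V : Type*} (E : V → V → Prop) (k : ℕ) (hk : 1 ≤ k) :
    (∃ L : List V, L.Nodup ∧ k < L.length ∧
        ∀ e ∈ L.zip (L.rotate 1), E e.1 e.2) ↔
    (∃ a : Fin (k + 1) → V, Function.Injective a ∧
      (∀ i : Fin k, E (a i.castSucc) (a i.succ)) ∧
      ∃ p : List V, p.Nodup ∧ List.Chain' E p ∧
        p.head? = some (a (Fin.last k)) ∧ p.getLast? = some (a 0) ∧
        ∀ e ∈ p.zip p.tail, ∀ i : Fin k, e.1 ≠ a i.castSucc) := by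
  constructor
  · rintro ⟨L, hnd, hlen, hE⟩
    obtain _ | ⟨x, t⟩ := L
    · simp at hlen
    have hrot : (x :: t).rotate 1 = t ++ [x] := by simp
    rw [hrot, aux_isChain_zip, List.isChain_iff_getElem] at hE
    have hlen2 : k < t.length + 1 := by simpa using hlen
    have hdrop : (x :: t).drop k = t.drop (k - 1) := by
      obtain ⟨j, rfl⟩ : ∃ j, k = j + 1 := ⟨k - 1, by omega⟩
      simp
    have hget : ∀ i (h : i < (x :: t).length) (h2 : i < (x :: (t ++ [x])).length),
        (x :: (t ++ [x]))[i] = (x :: t)[i] := by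
      intro i h h2
      have := List.getElem_append_left (as := x :: t) (bs := [x]) h (h' := h2)
      simpa using this
    have hnd2 := hnd
    rw [List.nodup_iff_injective_get] at hnd2
    refine ⟨fun i => (x :: t).get ⟨i, by have := i.2; simp; omega⟩, ?_, ?_, ?_⟩
    · intro i j hij
      have := hnd2 hij
      simpa [Fin.ext_iff] using this
    · intro i
      have hi := i.2
      have h := hE i (by simp; omega)
      rw [hget i (by simp; omega), hget (i + 1) (by simp; omega)] at h
      exact h
    · refine ⟨(x :: t).drop k ++ [x], ?_, ?_, ?_, ?_, ?_⟩
      · rw [hdrop, List.nodup_append]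
        have hx := List.nodup_cons.1 hnd
        refine ⟨hx.2.sublist (List.drop_sublist _ _), by simp, ?_⟩
        intro a ha b hb
        simp at hb
        subst hb
        rintro rfl
        exact hx.1 (List.mem_of_mem_drop ha)
      · have h1 : (x :: t).drop k ++ [x] = (x :: (t ++ [x])).drop k := by
          rw [← List.cons_append, List.drop_append_of_le_length hlen.le]
        rw [h1]
        exact (List.isChain_iff_getElem.2 hE).drop k
      · rw [List.head?_append, List.head?_drop, List.getElem?_eq_getElem hlen]
        simp
      · simp
      · intro e he i hei
        have h1 : ((x :: t).drop k ++ [x]).zip ((x :: t).drop k ++ [x]).tail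
            = ((x :: t).drop k).zip ((x :: t).drop k ++ [x]).tail := by
          have h2 : ((x :: t).drop k ++ [x]).tail = ((x :: t).drop k ++ [x]).tail ++ [] := by simp
          conv_lhs => rw [h2]
          rw [List.zip_append (by simp)]
          simp
        rw [h1] at he
        have he1 := (List.of_mem_zip (a := e.1) (b := e.2) he).1
        obtain ⟨j, hj, hj2⟩ := List.mem_iff_getElem.1 he1
        rw [List.getElem_drop] at hj2
        rw [hei] at hj2
        have := (List.Nodup.getElem_inj_iff hnd).1 hj2
        have hi := i.2
        simp at this
        omega
  · rintro ⟨a, hinj, hE, p, hnd, hch, hh, hl, htail⟩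
    obtain ⟨q, rfl⟩ := List.getLast?_eq_some_iff.1 hl
    have hqn : q ≠ [] := by
      rintro rfl
      simp at hh
      have := hinj hh
      simp [Fin.ext_iff] at this
      omega
    have hql : 0 < q.length := List.length_pos_iff.2 hqn
    obtain ⟨j, rfl⟩ : ∃ j, k = j + 1 := ⟨k - 1, by omega⟩
    have hch2 : List.IsChain E (List.ofFn (fun i : Fin (j + 1) => a i.castSucc) ++ (q ++ [a 0])) := by
      rw [List.isChain_append]
      refine ⟨?_, hch, ?_⟩
      · rw [List.isChain_ofFn]
        intro i hi
        exact hE ⟨i, by omega⟩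
      · intro u hu v hv
        rw [hh] at hv
        rw [List.ofFn_succ', List.concat_eq_append, List.getLast?_append] at hu
        simp at hu hv
        subst hu hv
        exact hE (Fin.last j)
    refine ⟨List.ofFn (fun i : Fin (j + 1) => a i.castSucc) ++ q, ?_, ?_, ?_⟩
    · rw [List.nodup_append]
      refine ⟨List.nodup_ofFn.2 (hinj.comp (Fin.castSucc_injective _)),
        (List.nodup_append.1 hnd).1, ?_⟩
      rintro u hu v hv rfl
      obtain ⟨i, rfl⟩ := (List.mem_ofFn' _ _).1 hu
      obtain ⟨z, hz⟩ := aux_mem_zip_tail q (a 0) _ hv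
      exact htail _ hz i rfl
    · simp; omega
    · rw [List.ofFn_succ] at hch2 ⊢
      rw [List.cons_append, List.rotate_cons_succ, List.rotate_zero, aux_isChain_zip]
      simpa using hch2
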